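/- Consider the action of the relabeling group G of the square scenario — the group generated by the dihedral group D₈ of order 8 permuting the four coordinates (the automorphism group of the 4-cycle on observers A,B,C,D) and all independent flips of each binary outcome (the group (S₂)⁴) — on the set of patterns, i.e. Boolean-valued functions (Fin 2)⁴ → Bool. Then the set of the 65535 patterns that are not identically false decomposes into exactly 804 orbits under this action. -/

import Mathlib

/-- Adjacency in the 4-cycle A–B–C–D–A on `Fin 4`. -/
def cycAdj (i j : Fin 4) : Prop := j = i + 1 ∨ i = j + 1

/-- Two square patterns are related by a relabeling: a symmetry of the square
(an adjacency-preserving permutation of the four observers, i.e. an element of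
the dihedral group `D₈` of order 8) together with an independent relabeling of
each observer's binary outcome. -/
def sqRel (P Q : (Fin 4 → Fin 2) → Bool) : Prop :=
  ∃ (σ : Equiv.Perm (Fin 4)) (π : Fin 4 → Equiv.Perm (Fin 2)),
    (∀ i j, cycAdj (σ i) (σ j) ↔ cycAdj i j) ∧
    ∀ v : Fin 4 → Fin 2, Q v = P fun i => π i (v (σ i))

/-- The orbit of a square pattern under the relabeling group. -/
def sqOrbit (P : (Fin 4 → Fin 2) → Bool) : Set ((Fin 4 → Fin 2) → Bool) :=
  {Q | sqRel P Q}

/-- A Boolean function invariant under a periodic map `g` is determined by its free choice of values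
on the points whose code is least in their `g`-orbit. -/
theorem card_invariant_eq_two_pow {V : Type*} [Fintype V] (g : V → V) (c : V → ℕ)
    (hc : Function.Injective c) (n : ℕ) (hn : 0 < n) (hg : ∀ v, g^[n] v = v) :
    Nat.card {P : V → Bool // ∀ v, P (g v) = P v} =
      2 ^ (Finset.univ.filter fun v => ∀ k : Fin n, c v ≤ c (g^[k] v)).card := by
  set S := Finset.univ.filter fun v => ∀ k : Fin n, c v ≤ c (g^[k] v) with hS
  have mem_S (v : V) : v ∈ S ↔ ∀ j, c v ≤ c (g^[j] v) := by
    refine ⟨fun h j => ?_, fun h => by simpa [hS] using fun k : Fin n => h k⟩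
    have hp : Function.IsPeriodicPt g n v := hg v
    rw [← hp.iterate_mod_apply j]
    exact (Finset.mem_filter.1 h).2 ⟨j % n, Nat.mod_lt _ hn⟩
  have key (v : V) : ∃ w, (∃ k, w = g^[k] v) ∧ ∀ j, c w ≤ c (g^[j] v) :=
    ⟨_, ⟨_, rfl⟩, fun j => Function.argmin_le (fun j => c (g^[j] v)) j⟩
  choose r hr hmin using key
  have r_mem (v : V) : r v ∈ S := by
    obtain ⟨k, hk⟩ := hr v
    refine (mem_S _).2 fun j => ?_
    conv_rhs => rw [hk, ← Function.iterate_add_apply]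
    exact hmin v _
  have r_apply (v : V) : r (g v) = r v := by
    apply hc
    apply le_antisymm
    · obtain ⟨k, hk⟩ := hr v
      obtain ⟨m, rfl⟩ : ∃ m, n = m + 1 := ⟨n - 1, by omega⟩
      have : r v = g^[k + m] (g v) := by
        rw [← Function.iterate_succ_apply, Nat.succ_eq_add_one, add_assoc,
          Function.iterate_add_apply, hg, hk]
      rw [this]
      exact hmin _ _
    · obtain ⟨k, hk⟩ := hr (g v)
      rw [hk, ← Function.iterate_succ_apply]
      exact hmin _ _
  have r_self (v : V) (hv : v ∈ S) : r v = v := by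
    obtain ⟨k, hk⟩ := hr v
    refine hc (le_antisymm (hmin v 0) ?_)
    rw [hk]
    exact (mem_S v).1 hv k
  have inv_r (P : V → Bool) (hP : ∀ v, P (g v) = P v) (v : V) : P (r v) = P v := by
    obtain ⟨k, hk⟩ := hr v
    rw [hk]
    clear hk
    induction k with
    | zero => rfl
    | succ k ih => rw [Function.iterate_succ_apply', hP, ih]
  have e : {P : V → Bool // ∀ v, P (g v) = P v} ≃ (S → Bool) :=
    { toFun := fun P v => P.1 v
      invFun := fun q => ⟨fun v => q ⟨r v, r_mem v⟩, fun v => by simp only [r_apply]⟩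
      left_inv := fun P => Subtype.ext <| funext fun v => inv_r P.1 P.2 v
      right_inv := fun q => funext fun v => by simp only [r_self v v.2] }
  rw [Nat.card_congr e, Nat.card_fun, Nat.card_eq_fintype_card, Fintype.card_bool,
    Nat.card_eq_fintype_card, Fintype.card_coe]

/-- The outcome relabeling that reads coordinate `r ± i` into place `i` and then adds `m i`, for
`k = (±, r, m)`. -/
def relabel (k : Bool × Fin 4 × (Fin 4 → Fin 2)) (v : Fin 4 → Fin 2) : Fin 4 → Fin 2 :=
  fun i => v (bif k.1 then k.2.1 - i else k.2.1 + i) + k.2.2 i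

/-- The number with binary digits `v`. -/
def binaryCode (v : Fin 4 → Fin 2) : ℕ := v 0 + 2 * v 1 + 4 * v 2 + 8 * v 3

theorem binaryCode_injective : Function.Injective binaryCode := by
  intro v w h
  unfold binaryCode at h
  funext i
  fin_cases i <;> ext <;> dsimp <;> omega

/-- The effect of `relabel k` on binary codes. -/
def relabelCode (k : Bool × Fin 4 × (Fin 4 → Fin 2)) (x : ℕ) : ℕ :=
  let digit (i : ℕ) : ℕ := x / 2 ^ ((bif k.1 then k.2.1 + (4 - i) else k.2.1 + i) % 4) % 2
  (digit 0 + 2 * digit 1 + 4 * digit 2 + 8 * digit 3) ^^^ binaryCode k.2.2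

theorem binaryCode_relabel (k : Bool × Fin 4 × (Fin 4 → Fin 2)) (v : Fin 4 → Fin 2) :
    binaryCode (relabel k v) = relabelCode k (binaryCode v) := by
  revert k v
  decide +kernel

theorem binaryCode_relabel_iterate (k : Bool × Fin 4 × (Fin 4 → Fin 2)) (n : ℕ)
    (v : Fin 4 → Fin 2) :
    binaryCode ((relabel k)^[n] v) = (relabelCode k)^[n] (binaryCode v) :=
  Function.Semiconj.iterate_right (f := binaryCode) (binaryCode_relabel k) n v

theorem sum_two_pow_card_cycles :
    ∑ k : Bool × Fin 4 × (Fin 4 → Fin 2), 2 ^ (Finset.univ.filter fun v : Fin 4 → Fin 2 =>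
      ∀ n : Fin 8, binaryCode v ≤ binaryCode ((relabel k)^[n] v)).card = 805 * 128 := by
  simp only [binaryCode_relabel_iterate]
  decide +kernel

theorem relabel_iterate_eight (k : Bool × Fin 4 × (Fin 4 → Fin 2)) (v : Fin 4 → Fin 2) :
    (relabel k)^[8] v = v := by
  obtain ⟨s, r, m⟩ := k
  have add_add_self : ∀ x y : Fin 2, x + y + y = x := by decide
  have iterate_four (v : Fin 4 → Fin 2) (i : Fin 4) :
      (relabel (s, r, m))^[4] v i = v i + (relabel (s, r, m))^[4] 0 i := by
    fin_cases r <;> cases s <;> fin_cases i <;> simp [relabel, add_assoc]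
  rw [show 8 = 4 + 4 from rfl, Function.iterate_add_apply]
  funext i
  rw [iterate_four, iterate_four, add_add_self]

theorem relabel_injective : Function.Injective relabel := by
  have key : ∀ a b : Bool × Fin 4,
      (∀ (v : Fin 4 → Fin 2) (i : Fin 4),
        v (bif a.1 then a.2 - i else a.2 + i) = v (bif b.1 then b.2 - i else b.2 + i)) →
      a = b := by
    decide +kernel
  rintro ⟨s, r, m⟩ ⟨s', r', m'⟩ h
  have hm : m = m' := by
    funext i
    simpa [relabel] using congrFun (congrFun h 0) i
  subst hm
  have := key (s, r) (s', r') fun v i => by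
    simpa [relabel] using congrFun (congrFun h v) i
  simp_all

instance (i j : Fin 4) : Decidable (cycAdj i j) := inferInstanceAs (Decidable (_ ∨ _))

theorem cycAdj_add_or_sub (s : Bool) (r i j : Fin 4) :
    cycAdj (bif s then r - i else r + i) (bif s then r - j else r + j) ↔ cycAdj i j := by
  revert s r i j
  decide

theorem exists_eq_add_or_sub (σ : Equiv.Perm (Fin 4))
    (hσ : ∀ i j, cycAdj (σ i) (σ j) ↔ cycAdj i j) :
    ∃ (s : Bool) (r : Fin 4), ∀ i, σ i = bif s then r - i else r + i := by
  revert σ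
  decide +kernel

theorem perm_fin_two_apply (p : Equiv.Perm (Fin 2)) (x : Fin 2) : p x = x + p 0 := by
  revert p x
  decide

/-- The relabeling group of the square scenario, as permutations of the outcome quadruples. -/
def relabelGroup : Subgroup (Equiv.Perm (Fin 4 → Fin 2)) where
  carrier := {g | ∃ (σ : Equiv.Perm (Fin 4)) (π : Fin 4 → Equiv.Perm (Fin 2)),
    (∀ i j, cycAdj (σ i) (σ j) ↔ cycAdj i j) ∧ ∀ v i, g v i = π i (v (σ i))}
  one_mem' := ⟨1, 1, fun _ _ => Iff.rfl, fun _ _ => rfl⟩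
  mul_mem' := by
    rintro g h ⟨σ, π, hσ, hg⟩ ⟨τ, ρ, hτ, hh⟩
    exact ⟨τ * σ, fun i => π i * ρ (σ i), fun i j => (hτ _ _).trans (hσ i j),
      fun v i => by simp [hg, hh]⟩
  inv_mem' := by
    rintro g ⟨σ, π, hσ, hg⟩
    refine ⟨σ⁻¹, fun j => (π (σ⁻¹ j))⁻¹, fun i j => ?_, fun v i => ?_⟩
    · rw [← hσ, Equiv.Perm.inv_def, Equiv.apply_symm_apply, Equiv.apply_symm_apply]
    · obtain ⟨w, rfl⟩ := g.surjective v
      simp [hg]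

/-- `relabel k` as a permutation. -/
def relabelPerm (k : Bool × Fin 4 × (Fin 4 → Fin 2)) : Equiv.Perm (Fin 4 → Fin 2) where
  toFun := relabel k
  invFun := (relabel k)^[7]
  left_inv v := relabel_iterate_eight k v
  right_inv v := by
    rw [← Function.iterate_succ_apply' (relabel k)]
    exact relabel_iterate_eight k v

theorem relabelPerm_mem (k : Bool × Fin 4 × (Fin 4 → Fin 2)) :
    relabelPerm k ∈ relabelGroup := by
  obtain ⟨s, r, m⟩ := k
  have hinj : Function.Injective fun i : Fin 4 => bif s then r - i else r + i := by
    cases s <;> intro i j h <;> simpa using h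
  exact ⟨Equiv.ofBijective _ (Finite.injective_iff_bijective.1 hinj),
    fun i => Equiv.addRight (m i), fun i j => cycAdj_add_or_sub s r i j, fun _ _ => rfl⟩

theorem relabelPerm_bijective :
    Function.Bijective fun k => (⟨relabelPerm k, relabelPerm_mem k⟩ : relabelGroup) := by
  constructor
  · intro k l h
    exact relabel_injective (congrArg (fun g : relabelGroup => ⇑g.1) h)
  · rintro ⟨g, σ, π, hσ, hg⟩
    obtain ⟨s, r, hsr⟩ := exists_eq_add_or_sub σ hσ
    refine ⟨(s, r, fun i => π i 0), Subtype.ext <| Equiv.ext fun v => funext fun i => ?_⟩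
    rw [hg, perm_fin_two_apply, hsr]
    rfl

attribute [local instance] arrowAction

theorem smul_apply_inv (g : relabelGroup) (P : (Fin 4 → Fin 2) → Bool) (v : Fin 4 → Fin 2) :
    (g⁻¹ • P) v = P (g.1 v) := by
  change P ((g⁻¹)⁻¹ • v) = _
  rw [inv_inv]
  rfl

theorem sqOrbit_eq_orbit (P : (Fin 4 → Fin 2) → Bool) :
    sqOrbit P = MulAction.orbit relabelGroup P := by
  ext Q
  constructor
  · rintro ⟨σ, π, hσ, hQ⟩
    obtain ⟨s, r, hsr⟩ := exists_eq_add_or_sub σ hσ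
    let g : relabelGroup := ⟨relabelPerm (s, r, fun i => π i 0), relabelPerm_mem _⟩
    refine ⟨g⁻¹, funext fun v => ?_⟩
    rw [hQ]
    refine (smul_apply_inv g P v).trans (congrArg P (funext fun i => ?_))
    rw [perm_fin_two_apply (π i), hsr]
    rfl
  · rintro ⟨g, rfl⟩
    obtain ⟨σ, π, hσ, hg⟩ := (g⁻¹).2
    refine ⟨σ, π, hσ, fun v => ?_⟩
    have := smul_apply_inv g⁻¹ P v
    rw [inv_inv] at this
    exact this.trans (congrArg P (funext (hg v)))

theorem card_fixedBy_relabelPerm (k : Bool × Fin 4 × (Fin 4 → Fin 2)) :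
    Nat.card (MulAction.fixedBy ((Fin 4 → Fin 2) → Bool)
        (⟨relabelPerm k, relabelPerm_mem k⟩ : relabelGroup)) =
      2 ^ (Finset.univ.filter fun v : Fin 4 → Fin 2 =>
        ∀ n : Fin 8, binaryCode v ≤ binaryCode ((relabel k)^[n] v)).card := by
  rw [← card_invariant_eq_two_pow (relabel k) binaryCode binaryCode_injective 8 (by norm_num)
    (relabel_iterate_eight k)]
  refine Nat.card_congr (Equiv.subtypeEquivRight fun P => ?_)
  rw [← MulAction.fixedBy_inv, MulAction.mem_fixedBy, funext_iff]
  exact forall_congr' fun v => by rw [smul_apply_inv]; rfl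

theorem card_orbitRel_quotient :
    Nat.card (MulAction.orbitRel.Quotient relabelGroup ((Fin 4 → Fin 2) → Bool)) = 805 := by
  classical
  let e := Equiv.ofBijective _ relabelPerm_bijective
  let _ : Fintype relabelGroup := Fintype.ofEquiv _ e
  let _ : Fintype (Quotient (MulAction.orbitRel relabelGroup ((Fin 4 → Fin 2) → Bool))) :=
    Fintype.ofFinite _
  have h := MulAction.sum_card_fixedBy_eq_card_orbits_mul_card_group relabelGroup
    ((Fin 4 → Fin 2) → Bool)
  have hcard : Fintype.card relabelGroup = 128 := by
    rw [← Fintype.card_congr e]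
    simp
  rw [hcard, ← e.sum_comp] at h
  simp only [← Nat.card_eq_fintype_card] at h
  rw [Finset.sum_congr rfl fun k _ => show Nat.card (MulAction.fixedBy _ (e k)) = _ from
    card_fixedBy_relabelPerm k, sum_two_pow_card_cycles] at h
  exact (Nat.eq_of_mul_eq_mul_right (by norm_num) h).symm

theorem range_sqOrbit_ncard : (Set.range sqOrbit).ncard = 805 := by
  have h : Set.range sqOrbit = Set.range (MulAction.orbitRel.Quotient.orbit :
      MulAction.orbitRel.Quotient relabelGroup ((Fin 4 → Fin 2) → Bool) → _) := by
    rw [funext sqOrbit_eq_orbit, ← Quotient.mk''_surjective.range_comp]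
    rfl
  rw [h, ← card_orbitRel_quotient, ← Nat.card_coe_set_eq]
  exact Nat.card_range_of_injective MulAction.orbitRel.Quotient.orbit_injective

/-- In the square scenario, the 65535 patterns that are not identically false
decompose into exactly 804 orbits under the relabeling group. -/
theorem square_pattern_orbit_count :
    Nat.card {P : (Fin 4 → Fin 2) → Bool // P ≠ fun _ => false} = 65535 ∧
    Set.ncard {O : Set ((Fin 4 → Fin 2) → Bool) |
      ∃ P : (Fin 4 → Fin 2) → Bool,
        P ≠ (fun _ => false) ∧ O = sqOrbit P} = 804 := by
  constructor
  · rw [Nat.card_eq_fintype_card, Fintype.card_subtype_compl]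
    simp
  · have self_mem (P) : P ∈ sqOrbit P := by
      rw [sqOrbit_eq_orbit]
      exact MulAction.mem_orbit_self P
    have zero_notMem (P : (Fin 4 → Fin 2) → Bool) (hP : P ≠ fun _ => false) :
        sqOrbit P ≠ sqOrbit fun _ => false := by
      intro h
      obtain ⟨σ, π, -, hQ⟩ : P ∈ sqOrbit fun _ => false := h ▸ self_mem P
      exact hP (funext hQ)
    have h : {O | ∃ P : (Fin 4 → Fin 2) → Bool, P ≠ (fun _ => false) ∧ O = sqOrbit P} =
        Set.range sqOrbit \ {sqOrbit fun _ => false} := by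
      ext O
      constructor
      · rintro ⟨P, hP, rfl⟩
        exact ⟨⟨P, rfl⟩, zero_notMem P hP⟩
      · rintro ⟨⟨P, rfl⟩, hP⟩
        exact ⟨P, fun h => hP (congrArg sqOrbit h), rfl⟩
    rw [h, Set.ncard_sdiff_singleton_of_mem (Set.mem_range_self _), range_sqOrbit_ncard]
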